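/- arXiv:2406.19134 — 2 statements merged into one kernel-verified Lean document; each statement's English description precedes it below -/
import Mathlib

section
/- Let G be a connected finite simple undirected graph, T ⊆ V(G) a set of terminals with |T| ≥ 3, let k ≥ 2, and let S be a nonempty strong separator for T with respect to k. Then there exist two terminal components C₁ and C₂ of G − S such that every multiway cut O for T with 1 ≤ |O| ≤ k satisfies: O ∩ S ≠ ∅, or 1 ≤ |O ∩ V(C₁)| ≤ k−1, or 1 ≤ |O ∩ V(C₂)| ≤ k−1. -/
/-- Reachability in the undirected graph `G` after deleting the vertex set `S`. -/
def ReachAvoid {V : Type*} (G : SimpleGraph V) (S : Set V) (u v : V) : Prop :=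
  Relation.ReflTransGen (fun x y => G.Adj x y ∧ x ∉ S ∧ y ∉ S) u v

/-- `S` is a multiway cut for the terminal set `T` in `G`: `S ⊆ V(G) \ T` and every
connected component of `G − S` contains at most one vertex of `T`. -/
def IsMultiwayCut {V : Type*} (G : SimpleGraph V) (T S : Set V) : Prop :=
  S ∩ T = ∅ ∧ ∀ t₁ ∈ T, ∀ t₂ ∈ T, t₁ ≠ t₂ → ¬ ReachAvoid G S t₁ t₂

/-- `S` is a minimal multiway cut for `T` in `G`. -/
def IsMinimalMultiwayCut {V : Type*} (G : SimpleGraph V) (T S : Set V) : Prop :=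
  IsMultiwayCut G T S ∧ ∀ S' : Set V, S' ⊂ S → ¬ IsMultiwayCut G T S'

/-- The connected component of `G − S` containing `x`. -/
def CompAvoid {V : Type*} (G : SimpleGraph V) (S : Set V) (x : V) : Set V :=
  {y | ReachAvoid G S x y}

/-- Reachability inside the induced subgraph `G[S]`. -/
def ReachIn {V : Type*} (G : SimpleGraph V) (S : Set V) (u v : V) : Prop :=
  Relation.ReflTransGen (fun x y => G.Adj x y ∧ x ∈ S ∧ y ∈ S) u v

/-- The connected component of the induced subgraph `G[S]` containing `w`. -/
def SCompOf {V : Type*} (G : SimpleGraph V) (S : Set V) (w : V) : Set V :=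
  {y | ReachIn G S w y}

/-- Two vertex sets are adjacent if some vertex of one has a neighbor in the other. -/
def AdjSets {V : Type*} (G : SimpleGraph V) (C D : Set V) : Prop :=
  ∃ c ∈ C, ∃ d ∈ D, G.Adj c d

/-- The terminal components of `G − S`: components of `G − S` containing a terminal. -/
def TermComps {V : Type*} (G : SimpleGraph V) (T S : Set V) : Set (Set V) :=
  {C | ∃ t ∈ T, C = CompAvoid G S t}

/-- `C` is a large component of `G − S`: a component of `G − S` adjacent to every
connected component of `G[S]`. -/
def IsLargeComp {V : Type*} (G : SimpleGraph V) (S : Set V) (C : Set V) : Prop :=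
  (∃ x : V, x ∉ S ∧ C = CompAvoid G S x) ∧ ∀ w ∈ S, AdjSets G C (SCompOf G S w)

/-- The configuration `⟨G,T,S⟩` is bad: every connected component of `G[S]` is
adjacent to exactly two terminal components of `G − S`, and `G − S` has a large
component. -/
def IsBadConfig {V : Type*} (G : SimpleGraph V) (T S : Set V) : Prop :=
  (∀ w ∈ S, ∃ C₁ C₂ : Set V, C₁ ≠ C₂ ∧
      {C | C ∈ TermComps G T S ∧ AdjSets G C (SCompOf G S w)} = {C₁, C₂}) ∧
  ∃ C : Set V, IsLargeComp G S C

/-- The configuration `⟨G,T,S⟩` is good if it is not bad. -/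
def IsGoodConfig {V : Type*} (G : SimpleGraph V) (T S : Set V) : Prop :=
  ¬ IsBadConfig G T S

/-- `S` is a strong separator for `T` in `G` with respect to `k`: a minimal multiway
cut of size at most `k` such that either `⟨G,T,S⟩` is a good configuration, or
`⟨G,T,S⟩` is a bad configuration and no terminal component of `G − S` contains a
multiway cut for `T` of size at most `k`. -/
def IsStrongSeparator {V : Type*} (G : SimpleGraph V) (T : Set V) (k : ℕ)
    (S : Set V) : Prop :=
  IsMinimalMultiwayCut G T S ∧ S.ncard ≤ k ∧
    (IsGoodConfig G T S ∨
      (IsBadConfig G T S ∧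
        ∀ t ∈ T, ¬ ∃ O : Set V, IsMultiwayCut G T O ∧ O.ncard ≤ k ∧
          O ⊆ CompAvoid G S t))

section MultiwayCut

variable {V : Type*} {G : SimpleGraph V} {T S O : Set V}

theorem ReachAvoid.symm {u v : V} (h : ReachAvoid G S u v) : ReachAvoid G S v u :=
  by
  induction h with
  | refl => exact .refl
  | tail _ h ih => exact ih.head ⟨h.1.symm, h.2.2, h.2.1⟩

theorem ReachAvoid.notMem {u v : V} (h : ReachAvoid G S u v) (hu : u ∉ S) : v ∉ S := by
  induction h with
  | refl => exact hu
  | tail _ h _ => exact h.2.2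

theorem ReachIn.mem {u v : V} (h : ReachIn G S u v) (hu : u ∈ S) : v ∈ S := by
  induction h with
  | refl => exact hu
  | tail _ h _ => exact h.2.2

theorem IsMultiwayCut.notMem {t : V} (hS : IsMultiwayCut G T S) (ht : t ∈ T) : t ∉ S :=
  fun h => (Set.eq_empty_iff_forall_notMem.1 hS.1 t) ⟨h, ht⟩

/-- Components of `G − S` around distinct terminals are disjoint. -/
theorem IsMultiwayCut.eq_of_mem_compAvoid {t t' x : V} (hS : IsMultiwayCut G T S) (ht : t ∈ T)
    (ht' : t' ∈ T) (hx : x ∈ CompAvoid G S t) (hx' : x ∈ CompAvoid G S t') : t = t' := by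
  by_contra hne
  exact hS.2 t ht t' ht' hne (Relation.ReflTransGen.trans hx (ReachAvoid.symm hx'))

theorem ReachAvoid.of_inter_compAvoid_eq_empty {t c : V} (hO : O ∩ CompAvoid G S t = ∅)
    (h : ReachAvoid G S t c) : ReachAvoid G O t c := by
  have hn : ∀ x, ReachAvoid G S t x → x ∉ O := fun x hx hxO =>
    Set.eq_empty_iff_forall_notMem.1 hO x ⟨hxO, hx⟩
  induction h with
  | refl => exact .refl
  | tail h₁ h₂ ih => exact ih.tail ⟨h₂.1, hn _ h₁, hn _ (h₁.tail h₂)⟩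

theorem ReachIn.reachAvoid {u v : V} (hO : O ∩ S = ∅) (h : ReachIn G S u v) :
    ReachAvoid G O u v := by
  have hn : ∀ x ∈ S, x ∉ O := fun x hx hxO =>
    Set.eq_empty_iff_forall_notMem.1 hO x ⟨hxO, hx⟩
  induction h with
  | refl => exact .refl
  | tail _ h ih => exact ih.tail ⟨h.1, hn _ h.2.1, hn _ h.2.2⟩

theorem reachAvoid_of_adjSets {t w : V} (hw : w ∈ S) (hOS : O ∩ S = ∅)
    (h : AdjSets G (CompAvoid G S t) (SCompOf G S w)) (hO : O ∩ CompAvoid G S t = ∅) :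
    ReachAvoid G O w t := by
  obtain ⟨c, hc, d, hd, hcd⟩ := h
  have hcO : c ∉ O := fun hx => Set.eq_empty_iff_forall_notMem.1 hO c ⟨hx, hc⟩
  have hdO : d ∉ O := fun hx => Set.eq_empty_iff_forall_notMem.1 hOS d ⟨hx, ReachIn.mem hd hw⟩
  exact Relation.ReflTransGen.trans ((ReachIn.reachAvoid hOS hd).tail ⟨hcd.symm, hdO, hcO⟩)
    (ReachAvoid.of_inter_compAvoid_eq_empty hO hc).symm

/-- A multiway cut avoiding `S` meets one of any two terminal components sharing an adjacent
component of `G[S]`. -/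
theorem IsMultiwayCut.inter_compAvoid_ne_empty (hO : IsMultiwayCut G T O) (hOS : O ∩ S = ∅)
    {t t' w : V} (ht : t ∈ T) (ht' : t' ∈ T) (hne : t ≠ t') (hw : w ∈ S)
    (h : AdjSets G (CompAvoid G S t) (SCompOf G S w))
    (h' : AdjSets G (CompAvoid G S t') (SCompOf G S w)) :
    O ∩ CompAvoid G S t ≠ ∅ ∨ O ∩ CompAvoid G S t' ≠ ∅ := by
  by_contra! hcon
  exact hO.2 t ht t' ht' hne (Relation.ReflTransGen.trans
    (reachAvoid_of_adjSets hw hOS h hcon.1).symm (reachAvoid_of_adjSets hw hOS h' hcon.2))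

theorem ReachAvoid.or_exists_adj {w a b : V} (ha : a ∉ S)
    (h : ReachAvoid G (S \ {w}) a b) :
    ReachAvoid G S a b ∨ ∃ c ∈ CompAvoid G S a, G.Adj c w := by
  induction h with
  | refl => exact .inl .refl
  | @tail c d _ h ih =>
    refine ih.elim (fun hac => ?_) .inr
    by_cases hd : d = w
    · exact .inr ⟨c, hac, hd ▸ h.1⟩
    · exact .inl (hac.tail ⟨h.1, hac.notMem ha, fun hdS => h.2.2 ⟨hdS, hd⟩⟩)

/-- Every component of `G[S]` is adjacent to at least two terminal components. -/
theorem IsMinimalMultiwayCut.exists_pair_adjSets (hS : IsMinimalMultiwayCut G T S) {w : V}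
    (hw : w ∈ S) : ∃ t ∈ T, ∃ t' ∈ T, t ≠ t' ∧
      AdjSets G (CompAvoid G S t) (SCompOf G S w) ∧
      AdjSets G (CompAvoid G S t') (SCompOf G S w) := by
  have hnot := hS.2 (S \ {w}) (Set.sdiff_singleton_ssubset.2 hw)
  have hdisj : (S \ {w}) ∩ T = ∅ :=
    Set.subset_empty_iff.1 ((Set.inter_subset_inter_left T Set.sdiff_subset).trans hS.1.1.subset)
  simp only [IsMultiwayCut, hdisj, true_and] at hnot
  push Not at hnot
  obtain ⟨t, ht, t', ht', hne, h⟩ := hnot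
  have hadj : ∀ {a b : V}, a ∈ T → b ∈ T → a ≠ b → ReachAvoid G (S \ {w}) a b →
      AdjSets G (CompAvoid G S a) (SCompOf G S w) := fun {a b} ha hb hab hr => by
    obtain h | ⟨c, hc, hcw⟩ := hr.or_exists_adj (hS.1.notMem ha)
    · exact absurd h (hS.1.2 a ha b hb hab)
    · exact ⟨c, hc, w, .refl, hcw⟩
  exact ⟨t, ht, t', ht', hne, hadj ht ht' hne h, hadj ht' ht hne.symm h.symm⟩

/-- If some component of `G[S]` is adjacent to two terminal components other than that of `t`,
then the component of `t` contains no multiway cut. -/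
theorem IsMultiwayCut.not_subset_compAvoid (hS : IsMultiwayCut G T S) {t a b w : V} (ht : t ∈ T)
    (ha : a ∈ T) (hb : b ∈ T) (hta : t ≠ a) (htb : t ≠ b) (hab : a ≠ b) (hw : w ∈ S)
    (h : AdjSets G (CompAvoid G S a) (SCompOf G S w))
    (h' : AdjSets G (CompAvoid G S b) (SCompOf G S w)) (hO : IsMultiwayCut G T O) :
    ¬ O ⊆ CompAvoid G S t := by
  intro hsub
  have hOS : O ∩ S = ∅ := Set.eq_empty_iff_forall_notMem.2 fun x hx =>
    ReachAvoid.notMem (hsub hx.1) (hS.notMem ht) hx.2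
  have hempty : ∀ c ∈ T, t ≠ c → O ∩ CompAvoid G S c = ∅ := fun c hc htc =>
    Set.eq_empty_iff_forall_notMem.2 fun x hx =>
      htc (hS.eq_of_mem_compAvoid ht hc (hsub hx.1) hx.2)
  exact (hO.inter_compAvoid_ne_empty hOS ha hb hab hw h h').elim
    (fun hn => hn (hempty a ha hta)) (fun hn => hn (hempty b hb htb))

theorem one_le_ncard_inter_and_le [Finite V] {C : Set V} {k : ℕ} (hk : O.ncard ≤ k)
    (hsub : ¬ O ⊆ C) (hne : O ∩ C ≠ ∅) : 1 ≤ (O ∩ C).ncard ∧ (O ∩ C).ncard ≤ k - 1 := by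
  have h₁ : 0 < (O ∩ C).ncard := (Set.ncard_pos).2 (Set.nonempty_iff_ne_empty.2 hne)
  have h₂ : (O ∩ C).ncard < O.ncard :=
    Set.ncard_lt_ncard (Set.inter_ssubset_left_iff.2 hsub)
  omega

/-- A strong separator has two terminal components sharing an adjacent component of `G[S]`,
neither of which contains a multiway cut of size at most `k`. -/
theorem IsStrongSeparator.exists_pair {k : ℕ} (hS : IsStrongSeparator G T k S)
    (hSne : S.Nonempty) : ∃ t ∈ T, ∃ t' ∈ T, t ≠ t' ∧ ∃ w ∈ S,
      AdjSets G (CompAvoid G S t) (SCompOf G S w) ∧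
      AdjSets G (CompAvoid G S t') (SCompOf G S w) ∧
      ∀ O, IsMultiwayCut G T O → O.ncard ≤ k →
        ¬ O ⊆ CompAvoid G S t ∧ ¬ O ⊆ CompAvoid G S t' := by
  obtain ⟨hmin, -, hgood | ⟨-, hno⟩⟩ := hS
  · by_cases h3 : ∃ w ∈ S, ∃ a ∈ T, ∃ b ∈ T, ∃ c ∈ T, a ≠ b ∧ c ≠ a ∧ c ≠ b ∧
        AdjSets G (CompAvoid G S a) (SCompOf G S w) ∧
        AdjSets G (CompAvoid G S b) (SCompOf G S w) ∧
        AdjSets G (CompAvoid G S c) (SCompOf G S w)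
    · obtain ⟨w, hw, a, ha, b, hb, c, hc, hab, hca, hcb, hwa, hwb, hwc⟩ := h3
      exact ⟨a, ha, b, hb, hab, w, hw, hwa, hwb, fun O hO _ =>
        ⟨hmin.1.not_subset_compAvoid ha hb hc hab hca.symm hcb.symm hw hwb hwc hO,
          hmin.1.not_subset_compAvoid hb ha hc hab.symm hcb.symm hca.symm hw hwa hwc hO⟩⟩
    · have hlarge : ∀ t ∈ T, ∃ w ∈ S, ¬ AdjSets G (CompAvoid G S t) (SCompOf G S w) := by
        intro t ht
        by_contra! hall
        refine hgood ⟨fun w hw => ?_, CompAvoid G S t, ⟨t, hmin.1.notMem ht, rfl⟩, hall⟩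
        obtain ⟨a, ha, b, hb, hab, hwa, hwb⟩ := hmin.exists_pair_adjSets hw
        refine ⟨CompAvoid G S a, CompAvoid G S b, fun he => hab ?_, ?_⟩
        · exact hmin.1.eq_of_mem_compAvoid ha hb .refl (he ▸ .refl)
        · ext C
          simp only [Set.mem_ofPred_eq, Set.mem_insert_iff, Set.mem_singleton_iff]
          constructor
          · rintro ⟨⟨c, hc, rfl⟩, hwc⟩
            by_contra! hne
            exact h3 ⟨w, hw, a, ha, b, hb, c, hc, hab, fun h => hne.1 (h ▸ rfl),
              fun h => hne.2 (h ▸ rfl), hwa, hwb, hwc⟩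
          · rintro (rfl | rfl)
            exacts [⟨⟨a, ha, rfl⟩, hwa⟩, ⟨⟨b, hb, rfl⟩, hwb⟩]
      have hnsub : ∀ t ∈ T, ∀ O, IsMultiwayCut G T O → ¬ O ⊆ CompAvoid G S t := by
        intro t ht O hO
        obtain ⟨w, hw, hwt⟩ := hlarge t ht
        obtain ⟨a, ha, b, hb, hab, hwa, hwb⟩ := hmin.exists_pair_adjSets hw
        exact hmin.1.not_subset_compAvoid ht ha hb (fun h => hwt (h ▸ hwa))
          (fun h => hwt (h ▸ hwb)) hab hw hwa hwb hO
      obtain ⟨w, hw⟩ := hSne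
      obtain ⟨a, ha, b, hb, hab, hwa, hwb⟩ := hmin.exists_pair_adjSets hw
      exact ⟨a, ha, b, hb, hab, w, hw, hwa, hwb, fun O hO _ =>
        ⟨hnsub a ha O hO, hnsub b hb O hO⟩⟩
  · obtain ⟨w, hw⟩ := hSne
    obtain ⟨a, ha, b, hb, hab, hwa, hwb⟩ := hmin.exists_pair_adjSets hw
    exact ⟨a, ha, b, hb, hab, w, hw, hwa, hwb, fun O hO hk =>
      ⟨fun h => hno a ha ⟨O, hO, hk, h⟩, fun h => hno b hb ⟨O, hO, hk, h⟩⟩⟩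

end MultiwayCut

/-- Let `G` be connected, `|T| ≥ 3`, `k ≥ 2`, and `S` a nonempty
strong separator for `T` with respect to `k`.  Then there are two terminal
components `C₁, C₂` of `G − S` such that every multiway cut `O` for `T` with
`1 ≤ |O| ≤ k` satisfies `O ∩ S ≠ ∅`, or `1 ≤ |O ∩ V(C₁)| ≤ k−1`, or
`1 ≤ |O ∩ V(C₂)| ≤ k−1`. -/
theorem stmt13 {V : Type*} [Fintype V] (G : SimpleGraph V) (hG : G.Connected)
    (T : Set V) (hT : 3 ≤ T.ncard) (k : ℕ) (hk : 2 ≤ k)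
    (S : Set V) (hS : IsStrongSeparator G T k S) (hSne : S.Nonempty) :
    ∃ t₁ ∈ T, ∃ t₂ ∈ T, t₁ ≠ t₂ ∧ ¬ ReachAvoid G S t₁ t₂ ∧
      ∀ O : Set V, IsMultiwayCut G T O → 1 ≤ O.ncard → O.ncard ≤ k →
        (O ∩ S ≠ ∅ ∨
          (1 ≤ (O ∩ CompAvoid G S t₁).ncard ∧ (O ∩ CompAvoid G S t₁).ncard ≤ k - 1) ∨
          (1 ≤ (O ∩ CompAvoid G S t₂).ncard ∧ (O ∩ CompAvoid G S t₂).ncard ≤ k - 1)) := by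
  obtain ⟨t₁, h₁, t₂, h₂, hne, w, hw, hw₁, hw₂, hsub⟩ := hS.exists_pair hSne
  refine ⟨t₁, h₁, t₂, h₂, hne, hS.1.1.2 t₁ h₁ t₂ h₂ hne, fun O hO _ hOk => ?_⟩
  by_cases hOS : O ∩ S = ∅
  · obtain ⟨hs₁, hs₂⟩ := hsub O hO hOk
    exact .inr ((hO.inter_compAvoid_ne_empty hOS h₁ h₂ hne hw hw₁ hw₂).imp
      (one_le_ncard_inter_and_le hOk hs₁) (one_le_ncard_inter_and_le hOk hs₂))
  · exact .inl hOS
end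

section
/- For all positive integers p and q: every vertex (s,t)-cut of G_{p,q} has size at least 2p, and a set S ⊆ V(G_{p,q}) \ {s,t} with |S| = 2p is a vertex (s,t)-cut of G_{p,q} if and only if S = ⋃_{i=1}^p {a^i_{h_i}, b^i_{h_i}} for some h_1, …, h_p ∈ [q]. -/
/-- The vertex set of the graph `G_{p,q}`: vertices `s`, `t`, `a i j` and `b i j`
for `i ∈ [p]`, `j ∈ [q]`. -/
inductive Vpq (p q : ℕ) : Type where
  | s : Vpq p q
  | t : Vpq p q
  | a : Fin p → Fin q → Vpq p q
  | b : Fin p → Fin q → Vpq p q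
  deriving DecidableEq, Fintype

/-- The base adjacency relation of `G_{p,q}` (to be symmetrized): for each `i`,
`s` is adjacent to `a i 1` and `b i 1`, `t` is adjacent to `a i q` and `b i q`,
and for each `j ∈ [q−1]` each of `a i j` and `b i j` is adjacent to both
`a i (j+1)` and `b i (j+1)`. -/
def basePQ (p q : ℕ) : Vpq p q → Vpq p q → Prop
  | .s, .a _ j => j.val = 0
  | .s, .b _ j => j.val = 0
  | .a _ j, .t => j.val = q - 1
  | .b _ j, .t => j.val = q - 1
  | .a i j, .a i' j' => i = i' ∧ j'.val = j.val + 1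
  | .a i j, .b i' j' => i = i' ∧ j'.val = j.val + 1
  | .b i j, .a i' j' => i = i' ∧ j'.val = j.val + 1
  | .b i j, .b i' j' => i = i' ∧ j'.val = j.val + 1
  | _, _ => False

/-- The graph `G_{p,q}`. -/
def Gpq (p q : ℕ) : SimpleGraph (Vpq p q) := SimpleGraph.fromRel (basePQ p q)

/-- The set `W = ⋃_{i=1}^p {a^i_{j_i}, b^i_{j_i}}` determined by `j : Fin p → Fin q`. -/
def WSet (p q : ℕ) (jv : Fin p → Fin q) : Finset (Vpq p q) :=
  Finset.image (fun i => Vpq.a i (jv i)) Finset.univ ∪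
    Finset.image (fun i => Vpq.b i (jv i)) Finset.univ

/-- The family `𝓘_W` of independent sets of the matroid `M_W` (with `k = 2p`):
subsets of `V(G_{p,q}) \ {s,t}` of size at most `k − 1` are independent; sets
containing `s` or `t` or of size at least `k + 1` are not; a set `X` of size `k` is
independent iff `X = W`, or `|A_i ∩ X| ≥ 2` or `|B_i ∩ X| ≥ 2` for some `i`, or
`a^i_h, b^i_j ∈ X` for some `i` and distinct `h, j`. -/
def IndW (p q : ℕ) (jv : Fin p → Fin q) (X : Finset (Vpq p q)) : Prop :=
  Vpq.s ∉ X ∧ Vpq.t ∉ X ∧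
    (X.card ≤ 2 * p - 1 ∨
      (X.card = 2 * p ∧
        (X = WSet p q jv ∨
          ∃ i : Fin p,
            (∃ j j' : Fin q, j ≠ j' ∧ Vpq.a i j ∈ X ∧ Vpq.a i j' ∈ X) ∨
            (∃ j j' : Fin q, j ≠ j' ∧ Vpq.b i j ∈ X ∧ Vpq.b i j' ∈ X) ∨
            (∃ h j : Fin q, h ≠ j ∧ Vpq.a i h ∈ X ∧ Vpq.b i j ∈ X))))

/-- `S` is a vertex (s,t)-cut of the undirected graph `G`. -/
def IsVertexCut {V : Type*} (G : SimpleGraph V) (s t : V) (S : Set V) : Prop :=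
  s ∉ S ∧ t ∉ S ∧ ¬ ReachAvoid G S s t

theorem card_WSet (p q : ℕ) (h : Fin p → Fin q) : (WSet p q h).card = 2 * p := by
  unfold WSet
  rw [Finset.card_union_of_disjoint, Finset.card_image_of_injective,
    Finset.card_image_of_injective, Finset.card_univ, Fintype.card_fin, two_mul]
  · intro i j hij
    exact (Vpq.b.inj hij).1
  · intro i j hij
    exact (Vpq.a.inj hij).1
  · simp [Finset.disjoint_left]

theorem a_mem_WSet {p q : ℕ} {h : Fin p → Fin q} {i : Fin p} {j : Fin q} :
    Vpq.a i j ∈ WSet p q h ↔ h i = j := by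
  simp [WSet]

theorem b_mem_WSet {p q : ℕ} {h : Fin p → Fin q} {i : Fin p} {j : Fin q} :
    Vpq.b i j ∈ WSet p q h ↔ h i = j := by
  simp [WSet]

/-- The vertices on the `s`-side of the cut `WSet p q h`. -/
def SourceSide {p q : ℕ} (h : Fin p → Fin q) : Vpq p q → Prop
  | .s => True
  | .t => False
  | .a i j => j < h i
  | .b i j => j < h i

theorem SourceSide.of_adj {p q : ℕ} {h : Fin p → Fin q} {x y : Vpq p q}
    (hx : SourceSide h x) (hxy : (Gpq p q).Adj x y) (hy : y ∉ WSet p q h) :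
    SourceSide h y := by
  rw [Gpq, SimpleGraph.fromRel_adj] at hxy
  obtain ⟨-, hxy⟩ := hxy
  cases x <;> cases y <;>
    simp only [basePQ, SourceSide, a_mem_WSet, b_mem_WSet, Fin.lt_def, Fin.ext_iff] at * <;>
    grind

theorem isVertexCut_WSet (p q : ℕ) (h : Fin p → Fin q) :
    IsVertexCut (Gpq p q) Vpq.s Vpq.t (WSet p q h : Set (Vpq p q)) := by
  refine ⟨by simp [WSet], by simp [WSet], fun hst => ?_⟩
  have reach_side : ∀ v, ReachAvoid (Gpq p q) (WSet p q h : Set (Vpq p q)) Vpq.s v →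
      SourceSide h v := by
    intro v hv
    induction hv with
    | refl => trivial
    | tail _ hstep ih => exact ih.of_adj hstep.1 (by simpa using hstep.2.2)
  exact reach_side _ hst

theorem IsVertexCut.exists_layer {p q : ℕ} (hq : 0 < q) {S : Set (Vpq p q)}
    (hS : IsVertexCut (Gpq p q) Vpq.s Vpq.t S) (i : Fin p) :
    ∃ j, Vpq.a i j ∈ S ∧ Vpq.b i j ∈ S := by
  by_contra! hcon
  obtain ⟨hs, ht, hst⟩ := hS
  have avoid : ∀ j, ∃ v, v ∉ S ∧ (v = Vpq.a i j ∨ v = Vpq.b i j) := by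
    intro j
    by_cases ha : Vpq.a i j ∈ S
    · exact ⟨_, hcon j ha, Or.inr rfl⟩
    · exact ⟨_, ha, Or.inl rfl⟩
  choose c hcS hc using avoid
  have reach : ∀ n (hn : n < q), ReachAvoid (Gpq p q) S Vpq.s (c ⟨n, hn⟩) := by
    intro n
    induction n with
    | zero =>
      intro hn
      refine Relation.ReflTransGen.single ⟨?_, hs, hcS _⟩
      rcases hc ⟨0, hn⟩ with h | h <;> simp [h, Gpq, basePQ]
    | succ n ih =>
      intro hn
      refine (ih (by lia)).tail ⟨?_, hcS _, hcS _⟩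
      rcases hc ⟨n, by lia⟩ with h | h <;> rcases hc ⟨n + 1, hn⟩ with h' | h' <;>
        simp [h, h', Gpq, basePQ]
  refine hst ((reach (q - 1) (by lia)).tail ⟨?_, hcS _, ht⟩)
  rcases hc ⟨q - 1, by lia⟩ with h | h <;> simp [h, Gpq, basePQ]

theorem IsVertexCut.exists_WSet_subset {p q : ℕ} (hq : 0 < q) {S : Finset (Vpq p q)}
    (hS : IsVertexCut (Gpq p q) Vpq.s Vpq.t (S : Set (Vpq p q))) :
    ∃ h : Fin p → Fin q, WSet p q h ⊆ S := by
  choose h ha hb using hS.exists_layer hq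
  refine ⟨h, Finset.union_subset ?_ ?_⟩ <;> rw [Finset.image_subset_iff]
  · exact fun i _ => ha i
  · exact fun i _ => hb i

/-- every vertex (s,t)-cut of `G_{p,q}` has size at least `2p`, and a
set `S ⊆ V(G_{p,q}) \ {s,t}` with `|S| = 2p` is a vertex (s,t)-cut of `G_{p,q}` iff
`S = ⋃_{i=1}^p {a^i_{h_i}, b^i_{h_i}}` for some `h_1, …, h_p ∈ [q]`. -/
theorem stmt17 (p q : ℕ) (hp : 0 < p) (hq : 0 < q) :
    (∀ S : Finset (Vpq p q),
      IsVertexCut (Gpq p q) Vpq.s Vpq.t (S : Set (Vpq p q)) → 2 * p ≤ S.card) ∧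
    (∀ S : Finset (Vpq p q), Vpq.s ∉ S → Vpq.t ∉ S → S.card = 2 * p →
      (IsVertexCut (Gpq p q) Vpq.s Vpq.t (S : Set (Vpq p q)) ↔
        ∃ h : Fin p → Fin q, S = WSet p q h)) := by
  refine ⟨fun S hS => ?_, fun S _ _ hcard => ⟨fun hS => ?_, ?_⟩⟩
  · obtain ⟨h, hsub⟩ := hS.exists_WSet_subset hq
    exact card_WSet p q h ▸ Finset.card_le_card hsub
  · obtain ⟨h, hsub⟩ := hS.exists_WSet_subset hq
    exact ⟨h, (Finset.eq_of_subset_of_card_le hsub (by rw [hcard, card_WSet])).symm⟩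
  · rintro ⟨h, rfl⟩
    exact isVertexCut_WSet p q h
end
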